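/- Let n be a natural number and let T be a computable tree over Fin n. If the set [T] of infinite paths of T is nonempty and countable, then T has at least one computable infinite path, i.e., some f ∈ [T] with f : ℕ → Fin n a computable function. (In the paper's terminology: if there are countably many future worldlines of an event, at least one worldline is decidable.) -/

import Mathlib

/-- The initial segment (f 0, …, f (k-1)) of an infinite sequence f. -/
def initSeg {n : ℕ} (f : ℕ → Fin n) (k : ℕ) : List (Fin n) :=
  List.ofFn (fun i : Fin k => f i)

/-- A tree over `Fin n`: a set of finite strings closed under taking prefixes. -/
def IsTree {n : ℕ} (T : Set (List (Fin n))) : Prop :=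
  ∀ σ ∈ T, ∀ τ, τ <+: σ → τ ∈ T

/-- `f` is an infinite path of `T`: every initial segment of `f` belongs to `T`. -/
def IsPath {n : ℕ} (T : Set (List (Fin n))) (f : ℕ → Fin n) : Prop :=
  ∀ k : ℕ, initSeg f k ∈ T

/-- A bounded universal quantifier over a computable list is computable. -/
theorem computable_list_all {α β : Type*} [Primcodable α] [Primcodable β]
    {l : α → List β} {p : α → β → Bool} (hl : Computable l) (hp : Computable₂ p) :
    Computable fun a => (l a).all (p a) := by
  have h1 : Computable₂ (fun (a : α) (q : ℕ × Bool) =>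
      q.2 && (Option.casesOn ((l a)[q.1]?) true (p a) : Bool)) := by
    have hc : Computable (fun x : α × (ℕ × Bool) =>
        (Option.casesOn ((l x.1)[x.2.1]?) true (p x.1) : Bool)) := by
      refine Computable.option_casesOn (o := fun x : α × (ℕ × Bool) => (l x.1)[x.2.1]?)
        (f := fun _ => true) (g := fun x b => p x.1 b) ?_ (Computable.const _) ?_
      · exact Computable.list_getElem?.comp (hl.comp Computable.fst)
          (Computable.fst.comp Computable.snd)
      · exact hp.comp (Computable.fst.comp Computable.fst) Computable.snd
    exact Primrec.and.to_comp.comp (Computable.snd.comp Computable.snd) hc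
  refine (Computable.nat_rec (Computable.list_length.comp hl) (Computable.const true) h1).of_eq ?_
  intro a
  have key : ∀ i, i ≤ (l a).length → (Nat.rec (motive := fun _ => Bool) true
      (fun y IH => IH && (Option.casesOn ((l a)[y]?) true (p a) : Bool)) i)
      = ((l a).take i).all (p a) := by
    intro i
    induction i with
    | zero => simp
    | succ i ih =>
      intro hi
      have hi' : i < (l a).length := hi
      rw [List.take_succ_eq_append_getElem hi']
      simp only [ih (by omega), List.all_append, List.getElem?_eq_getElem hi']
      simp
  have := key _ le_rfl
  rw [List.take_length] at this
  exact this

/-- The list of all strings of length `N`. -/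
def allWords (n : ℕ) (N : ℕ) : List (List (Fin n)) :=
  Nat.rec (motive := fun _ => List (List (Fin n))) [[]]
    (fun _ W => W.flatMap fun τ => (List.finRange n).map fun a => a :: τ) N

theorem allWords_computable (n : ℕ) : Computable (allWords n) := by
  apply Primrec.to_comp
  refine Primrec.nat_rec₁ (f := fun _ W => W.flatMap fun τ =>
    (List.finRange n).map fun a => a :: τ) [[]] ?_
  refine Primrec.list_flatMap (f := fun x : ℕ × List (List (Fin n)) => x.2)
    (g := fun _ τ => (List.finRange n).map fun a => a :: τ) Primrec.snd ?_
  refine Primrec.list_map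
    (f := fun _ : (ℕ × List (List (Fin n))) × List (Fin n) => List.finRange n)
    (g := fun x a => a :: x.2) (Primrec.const _) ?_
  exact Primrec.list_cons.comp Primrec.snd (Primrec.snd.comp Primrec.fst)

theorem mem_allWords {n : ℕ} (N : ℕ) (τ : List (Fin n)) :
    τ ∈ allWords n N ↔ τ.length = N := by
  induction N generalizing τ with
  | zero => simp [allWords]
  | succ N ih =>
    have : allWords n (N+1) = (allWords n N).flatMap fun τ =>
      (List.finRange n).map fun a => a :: τ := rfl
    rw [this]
    cases τ with
    | nil => simp
    | cons a τ => simp [ih]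

theorem initSeg_isClosed {n : ℕ} (k : ℕ) (S : Set (List (Fin n))) :
    IsClosed {g : ℕ → Fin n | initSeg g k ∈ S} := by
  have hc : Continuous (fun (g : ℕ → Fin n) (i : Fin k) => g i) := by fun_prop
  exact (isClosed_discrete {h : Fin k → Fin n | List.ofFn h ∈ S}).preimage hc

theorem initSeg_mono {n : ℕ} (f : ℕ → Fin n) {k m : ℕ} (h : k ≤ m) :
    initSeg f k <+: initSeg f m := by
  rw [List.prefix_iff_eq_take]
  apply List.ext_getElem
  · simp [initSeg, h]
  · intro i h1 h2
    simp [initSeg]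

theorem isolated_path {n : ℕ} (T : Set (List (Fin n)))
    (hne : ∃ f : ℕ → Fin n, IsPath T f)
    (hcount : {f : ℕ → Fin n | IsPath T f}.Countable) :
    ∃ f : ℕ → Fin n, IsPath T f ∧ ∃ m, ∀ g, IsPath T g → (∀ i < m, g i = f i) → g = f := by
  have hcl : IsClosed {f : ℕ → Fin n | IsPath T f} := by
    have : {f : ℕ → Fin n | IsPath T f} = ⋂ k, {f | initSeg f k ∈ T} := by
      ext f; simp [IsPath]
    rw [this]
    exact isClosed_iInter fun k => initSeg_isClosed k T
  set S := {f : ℕ → Fin n | IsPath T f} with hS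
  have : CompactSpace S := isCompact_iff_compactSpace.1 hcl.isCompact
  have : Countable S := hcount
  have : Nonempty S := let ⟨f, hf⟩ := hne; ⟨⟨f, hf⟩⟩
  obtain ⟨x, y, hy⟩ := nonempty_interior_of_iUnion_of_closed (X := S) (f := fun x : S => {x})
    (fun _ => isClosed_singleton) (by ext x; simp)
  have hyx : y = x := Set.mem_singleton_iff.1 (interior_subset hy)
  subst hyx
  have ho := isOpen_interior (s := ({y} : Set S))
  obtain ⟨U, hU, hUe⟩ := isOpen_induced_iff.1 ho
  have hyU : (y : ℕ → Fin n) ∈ U := by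
    have : y ∈ Subtype.val ⁻¹' U := by rw [hUe]; exact hy
    exact this
  obtain ⟨V, ⟨z, m, rfl⟩, hyV, hVU⟩ :=
    (PiNat.isTopologicalBasis_cylinders (fun _ => Fin n)).exists_subset_of_mem_open hyU hU
  refine ⟨y, y.2, m, fun g hg hgy => ?_⟩
  have hgU : g ∈ U := hVU (by
    rw [PiNat.mem_cylinder_iff] at hyV ⊢
    intro i hi
    rw [hgy i hi, hyV i hi])
  have : (⟨g, hg⟩ : S) ∈ interior ({y} : Set S) := by rw [← hUe]; exact hgU
  have := interior_subset this
  exact congrArg Subtype.val this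

/-- König's lemma in the form needed here. -/
theorem konig_step {n : ℕ} (T : Set (List (Fin n))) (hT : IsTree T)
    (f : ℕ → Fin n) (m : ℕ)
    (hiso : ∀ g, IsPath T g → (∀ i < m, g i = f i) → g = f) (k : ℕ) :
    ∃ N, ∀ τ : List (Fin n), τ.length = N → initSeg f m ++ τ ∈ T →
      (initSeg f m ++ τ)[k]? = some (f k) := by
  by_contra hcon
  push Not at hcon
  let C : ℕ → Set (ℕ → Fin n) := fun N =>
    {g | initSeg g N ∈ T} ∩ ({g | initSeg g m ∈ ({initSeg f m} : Set _)} ∩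
      {g | g k ∈ ({f k}ᶜ : Set (Fin n))})
  have hCcl : ∀ N, IsClosed (C N) := fun N =>
    (initSeg_isClosed N T).inter ((initSeg_isClosed m _).inter
      ((isClosed_discrete _).preimage (continuous_apply k)))
  have hne : (⋂ N, C N).Nonempty := by
    apply IsCompact.nonempty_iInter_of_sequence_nonempty_isCompact_isClosed C
    · rintro N g ⟨h1, h2⟩
      exact ⟨hT _ h1 _ (initSeg_mono g (Nat.le_succ N)), h2⟩
    · intro N
      obtain ⟨τ, hlen, hmem, hk⟩ := hcon (N + k + 1)
      let g : ℕ → Fin n := fun i => (initSeg f m ++ τ).getD i (f 0)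
      have hL : (initSeg f m ++ τ).length = m + (N + k + 1) := by simp [initSeg, hlen]
      have hg : ∀ j ≤ m + (N + k + 1), initSeg g j = (initSeg f m ++ τ).take j := by
        intro j hj
        apply List.ext_getElem
        · rw [List.length_take, hL]; simp [initSeg, hj]
        · intro i h1 h2
          have h3 : i < (initSeg f m ++ τ).length := by
            rw [List.length_take] at h2; omega
          rw [List.getElem_take]
          simp only [initSeg, List.getElem_ofFn, g]
          exact List.getD_eq_getElem _ _ h3
      refine ⟨g, ?_, ?_, ?_⟩
      · show initSeg g N ∈ T
        rw [hg N (by omega)]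
        exact hT _ hmem _ ⟨_, List.take_append_drop _ _⟩
      · show initSeg g m = initSeg f m
        rw [hg m (by omega)]
        exact List.take_left' (by simp [initSeg])
      · show g k ≠ f k
        intro h
        apply hk
        have h3 : k < (initSeg f m ++ τ).length := by omega
        rw [List.getElem?_eq_getElem h3, ← h]
        exact congrArg some (List.getD_eq_getElem _ _ h3).symm
    · exact (hCcl 0).isCompact
    · exact hCcl
  obtain ⟨g, hg⟩ := hne
  rw [Set.mem_iInter] at hg
  have h1 : IsPath T g := fun N => (hg N).1
  have h2 : initSeg g m = initSeg f m := (hg 0).2.1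
  have h3 : g k ≠ f k := (hg 0).2.2
  apply h3
  rw [hiso g h1 ?_]
  intro i hi
  have := congrFun (List.ofFn_injective h2) ⟨i, hi⟩
  exact this

theorem initSeg_split {n : ℕ} (f : ℕ → Fin n) (m N : ℕ) :
    initSeg f m ++ initSeg (fun i => f (m + i)) N = initSeg f (m + N) := by
  apply List.ext_getElem
  · simp [initSeg]
  · intro i h1 h2
    rw [List.getElem_append]
    split_ifs with h
    · simp [initSeg]
    · have : m ≤ i := by simpa [initSeg] using h
      simp [initSeg, this]

/-- If the set of infinite paths of a computable tree is nonempty and countable,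
then the tree has a computable infinite path. -/
theorem countable_paths_have_computable_member {n : ℕ} (T : Set (List (Fin n)))
    (hT : IsTree T) (hTcomp : ComputablePred (· ∈ T))
    (hne : ∃ f : ℕ → Fin n, IsPath T f)
    (hcount : {f : ℕ → Fin n | IsPath T f}.Countable) :
    ∃ f : ℕ → Fin n, IsPath T f ∧ Computable f := by
  obtain ⟨f, hf, m, hiso⟩ := isolated_path T hne hcount
  refine ⟨f, hf, ?_⟩
  obtain ⟨hdec, hcomp⟩ := hTcomp
  set σ := initSeg f m with hσ
  -- the test on a word
  let p : ℕ × (Fin n × ℕ) → List (Fin n) → Bool := fun x τ =>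
    !(decide (σ ++ τ ∈ T)) || decide ((σ ++ τ)[x.1]? = some x.2.1)
  have hp : Computable₂ p := by
    have happ : Computable (fun y : (ℕ × (Fin n × ℕ)) × List (Fin n) => σ ++ y.2) :=
      Computable.list_append.comp (Computable.const σ) Computable.snd
    have h1 : Computable (fun y : (ℕ × (Fin n × ℕ)) × List (Fin n) =>
        decide (σ ++ y.2 ∈ T)) := hcomp.comp happ
    have heq : Computable₂ (fun a b : Option (Fin n) => decide (a = b)) :=
      (Primrec.eq (α := Option (Fin n))).decide.to_comp
    have h2 : Computable (fun y : (ℕ × (Fin n × ℕ)) × List (Fin n) =>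
        decide ((σ ++ y.2)[y.1.1]? = some y.1.2.1)) :=
      heq.comp
        (Computable.list_getElem?.comp happ (Computable.fst.comp Computable.fst))
        (Computable.option_some.comp
          (Computable.fst.comp (Computable.snd.comp Computable.fst)))
    exact Primrec.or.to_comp.comp (Primrec.not.to_comp.comp h1) h2
  let c : ℕ × (Fin n × ℕ) → Bool := fun x => (allWords n x.2.2).all (p x)
  have hc : Computable c := computable_list_all
    ((allWords_computable n).comp (Computable.snd.comp Computable.snd)) hp
  have hcspec : ∀ k a N, c (k, a, N) = true ↔
      ∀ τ : List (Fin n), τ.length = N → σ ++ τ ∈ T → (σ ++ τ)[k]? = some a := by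
    intro k a N
    simp only [c, p, List.all_eq_true, mem_allWords, Bool.or_eq_true, Bool.not_eq_true',
      decide_eq_false_iff_not, decide_eq_true_eq, imp_iff_not_or]
  have hsound : ∀ k a N, c (k, a, N) = true → a = f k := by
    intro k a N h
    have := (hcspec k a N).1 h (initSeg (fun i => f (m + i)) N) (by simp [initSeg])
      (by rw [hσ, initSeg_split]; exact hf _)
    rw [hσ, initSeg_split] at this
    obtain ⟨h1, h2⟩ := List.getElem?_eq_some_iff.1 this
    rw [← h2]; simp [initSeg]
  let s : ℕ → ℕ → Option (Fin n) := fun k j =>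
    Option.casesOn (Encodable.decode (α := Fin n × ℕ) j) none
      (fun q => bif c (k, q) then some q.1 else none)
  have hs : Computable₂ s := by
    refine Computable.option_casesOn
      (o := fun x : ℕ × ℕ => Encodable.decode (α := Fin n × ℕ) x.2)
      (f := fun _ => none) (g := fun x q => bif c (x.1, q) then some q.1 else none)
      (Computable.decode.comp Computable.snd) (Computable.const _) ?_
    exact Computable.cond
      (hc.comp (Computable.pair (Computable.fst.comp Computable.fst) Computable.snd))
      (Computable.option_some.comp (Computable.fst.comp Computable.snd)) (Computable.const _)
  have hs1 : ∀ k j a, a ∈ s k j → a = f k := by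
    intro k j a h
    simp only [s] at h
    cases hd : Encodable.decode (α := Fin n × ℕ) j with
    | none => simp [hd] at h
    | some q =>
      obtain ⟨b, N⟩ := q
      cases hcc : c (k, b, N) with
      | false => simp [hd, hcc] at h
      | true =>
        simp [hd, hcc] at h
        rw [← h]; exact hsound k b N hcc
  refine (Partrec.rfindOpt hs).of_eq_tot ?_
  intro k
  obtain ⟨N, hN⟩ := konig_step T hT f m hiso k
  have hck := (hcspec k (f k) N).2 hN
  have hdom : (Nat.rfindOpt (s k)).Dom := by
    rw [Nat.rfindOpt_dom]
    refine ⟨Encodable.encode (f k, N), f k, ?_⟩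
    simp only [s, Encodable.encodek, hck]
    rfl
  obtain ⟨j, hj⟩ := Nat.rfindOpt_spec (Part.get_mem hdom)
  rw [← hs1 k j _ hj]
  exact Part.get_mem hdom
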